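/- arXiv:math/9806094 — 4 statements merged into one kernel-verified Lean document; each statement's English description precedes it below -/
import Mathlib

section
/- For every 0 < r < 1, the pair {φ_c, −φ_c} is a 2-cycle of R_r: one has R_r(φ_c) = 2π − φ_c and R_r(2π − φ_c) = 2π + φ_c (i.e. R_r(φ_c) ≡ −φ_c and R_r(−φ_c) ≡ φ_c modulo 2π). -/
open Real Filter

/-- The reflection map of the unit circle with light source at `(r,0)`. -/
noncomputable def R (r : ℝ) (φ : ℝ) : ℝ :=
  φ + π - 2 * arctan (r * sin φ / (1 - r * cos φ))

/-- The angle `φ_c ∈ (0,π)` with `cos φ_c = (1 − √(1+8r²))/(4r)`. -/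
noncomputable def φc (r : ℝ) : ℝ :=
  arccos ((1 - Real.sqrt (1 + 8 * r ^ 2)) / (4 * r))

/-- `x`-coordinate of the caustic of `R_r^n`. -/
noncomputable def xc (r : ℝ) (n : ℕ) (φ : ℝ) : ℝ :=
  (deriv ((R r)^[n]) φ * cos φ + cos ((R r)^[n] φ)) / (1 + deriv ((R r)^[n]) φ)

/-- `y`-coordinate of the caustic of `R_r^n`. -/
noncomputable def yc (r : ℝ) (n : ℕ) (φ : ℝ) : ℝ :=
  (deriv ((R r)^[n]) φ * sin φ + sin ((R r)^[n] φ)) / (1 + deriv ((R r)^[n]) φ)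

/-- The quantity `A_n(φ) = −(R_r^n)'(φ) + ((R_r^n)'(φ))³ + 2 (R_r^n)'''(φ)`. -/
noncomputable def A (r : ℝ) (n : ℕ) (φ : ℝ) : ℝ :=
  -(deriv ((R r)^[n]) φ) + (deriv ((R r)^[n]) φ) ^ 3 + 2 * iteratedDeriv 3 ((R r)^[n]) φ

/-- `φ_c` lies in `(0, π)` and satisfies `2r cos² φ_c − cos φ_c − r = 0`. -/
lemma phic_spec {r : ℝ} (hr : 0 < r) :
    0 < φc r ∧ φc r < π ∧ 2 * r * cos (φc r) ^ 2 - cos (φc r) - r = 0 := by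
  have hs : Real.sqrt (1 + 8 * r ^ 2) ^ 2 = 1 + 8 * r ^ 2 := Real.sq_sqrt (by positivity)
  have hs0 := Real.sqrt_nonneg (1 + 8 * r ^ 2)
  have h1 : (1 - Real.sqrt (1 + 8 * r ^ 2)) / (4 * r) < 1 := by
    rw [div_lt_one (by positivity)]
    nlinarith
  have h2 : -1 < (1 - Real.sqrt (1 + 8 * r ^ 2)) / (4 * r) := by
    rw [lt_div_iff₀ (by positivity)]
    nlinarith
  have hcos : cos (φc r) = (1 - Real.sqrt (1 + 8 * r ^ 2)) / (4 * r) :=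
    Real.cos_arccos h2.le h1.le
  refine ⟨Real.arccos_pos.2 h1, ?_, ?_⟩
  · refine lt_of_le_of_ne (Real.arccos_le_pi _) fun h => ?_
    rw [φc, Real.arccos_eq_pi] at h
    linarith
  · rw [hcos]
    generalize Real.sqrt (1 + 8 * r ^ 2) = s at hs
    field_simp
    linear_combination 2 * hs

/-- The arctangent occurring in `R r (φc r)` equals `φc r - π / 2`. -/
lemma arctan_phic {r : ℝ} (hr : 0 < r) (hr1 : r < 1) :
    arctan (r * sin (φc r) / (1 - r * cos (φc r))) = φc r - π / 2 := by
  obtain ⟨h0, hπ, hq⟩ := phic_spec hr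
  have hsin : 0 < sin (φc r) := Real.sin_pos_of_pos_of_lt_pi h0 hπ
  have hden : 0 < 1 - r * cos (φc r) := by nlinarith [Real.cos_le_one (φc r)]
  have htan : tan (φc r - π / 2) = r * sin (φc r) / (1 - r * cos (φc r)) := by
    rw [Real.tan_eq_sin_div_cos, Real.sin_sub_pi_div_two, Real.cos_sub_pi_div_two,
      div_eq_div_iff hsin.ne' hden.ne']
    linear_combination hq - r * Real.sin_sq_add_cos_sq (φc r)
  rw [← htan, Real.arctan_tan (by linarith) (by linarith)]

theorem stmt_2 (r : ℝ) (hr : 0 < r) (hr1 : r < 1) :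
    R r (φc r) = 2 * π - φc r ∧ R r (2 * π - φc r) = 2 * π + φc r := by
  have h := arctan_phic hr hr1
  constructor
  · rw [R, h]
    ring
  · rw [R, Real.sin_two_pi_sub, Real.cos_two_pi_sub, mul_neg, neg_div, Real.arctan_neg, h]
    ring
end

section
/- For every 0 < r < 1 and every integer m ≥ 0, the derivatives of the odd iterates at 0 and π are (R_r^{2m+1})'(0) = ((1 − 3r)/(1 − r))^{m+1} · ((1 + 3r)/(1 + r))^{m} and (R_r^{2m+1})'(π) = ((1 − 3r)/(1 − r))^{m} · ((1 + 3r)/(1 + r))^{m+1}. -/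
open Real Filter

theorem one_sub_mul_neg_one_pow_pos {r : ℝ} (hr : 0 < r) (hr1 : r < 1) (k : ℕ) :
    0 < 1 - r * (-1) ^ k := by
  rcases neg_one_pow_eq_or ℝ k with h | h <;> rw [h] <;> linarith

theorem R_nat_mul_pi (r : ℝ) (k : ℕ) : R r (k * π) = (k + 1 : ℕ) * π := by
  simp only [R, sin_nat_mul_pi, mul_zero, zero_div, arctan_zero, sub_zero]
  push_cast
  ring

theorem hasDerivAt_R_nat_mul_pi {r : ℝ} (hr : 0 < r) (hr1 : r < 1) (k : ℕ) :
    HasDerivAt (R r) ((1 - 3 * r * (-1) ^ k) / (1 - r * (-1) ^ k)) (k * π) := by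
  have hk := (one_sub_mul_neg_one_pow_pos hr hr1 k).ne'
  have hden : 1 - r * cos (k * π) ≠ 0 := by rwa [cos_nat_mul_pi]
  have hquot := ((hasDerivAt_sin (k * π)).const_mul r).div
    (((hasDerivAt_cos (k * π)).const_mul r).const_sub 1) hden
  have hR := ((hasDerivAt_id (k * π)).add_const π).sub (hquot.arctan.const_mul 2)
  refine hR.congr_deriv ?_
  simp only [Pi.div_apply, sin_nat_mul_pi, cos_nat_mul_pi]
  field_simp
  ring

theorem hasDerivAt_iterate_R_nat_mul_pi {r : ℝ} (hr : 0 < r) (hr1 : r < 1) (n k : ℕ) :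
    HasDerivAt ((R r)^[n])
      (∏ i ∈ Finset.range n, (1 - 3 * r * (-1) ^ (k + i)) / (1 - r * (-1) ^ (k + i)))
      (k * π) := by
  induction n generalizing k with
  | zero => simpa using hasDerivAt_id (k * π)
  | succ n ih =>
    rw [Function.iterate_succ, Finset.prod_range_succ']
    have h := ih (k + 1)
    rw [← R_nat_mul_pi r k] at h
    refine (h.comp _ (hasDerivAt_R_nat_mul_pi hr hr1 k)).congr_deriv ?_
    simp only [add_zero, add_assoc, add_comm 1]

theorem prod_range_two_mul_add_one_of_alternating {M : Type*} [CommMonoid M] (f : ℕ → M)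
    (hf : ∀ i, f (i + 2) = f i) (m : ℕ) :
    ∏ i ∈ Finset.range (2 * m + 1), f i = f 0 ^ (m + 1) * f 1 ^ m := by
  have heven : ∀ j, f (2 * j) = f 0 := fun j => by
    induction j with
    | zero => rfl
    | succ j ih => rw [mul_add, mul_one, hf, ih]
  have hodd : ∀ j, f (2 * j + 1) = f 1 := fun j => by
    induction j with
    | zero => rfl
    | succ j ih => rw [show 2 * (j + 1) + 1 = 2 * j + 1 + 2 by ring, hf, ih]
  induction m with
  | zero => simp
  | succ m ih =>
    rw [show 2 * (m + 1) + 1 = 2 * m + 1 + 1 + 1 by ring, Finset.prod_range_succ,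
      Finset.prod_range_succ, ih, hodd, show 2 * m + 1 + 1 = 2 * (m + 1) by ring, heven,
      pow_succ (f 0) (m + 1), pow_succ (f 1) m]
    ac_rfl

theorem stmt_4 (r : ℝ) (hr : 0 < r) (hr1 : r < 1) (m : ℕ) :
    deriv ((R r)^[2 * m + 1]) 0 =
      ((1 - 3 * r) / (1 - r)) ^ (m + 1) * ((1 + 3 * r) / (1 + r)) ^ m ∧
    deriv ((R r)^[2 * m + 1]) π =
      ((1 - 3 * r) / (1 - r)) ^ m * ((1 + 3 * r) / (1 + r)) ^ (m + 1) := by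
  have h0 := (hasDerivAt_iterate_R_nat_mul_pi hr hr1 (2 * m + 1) 0).deriv
  have h1 := (hasDerivAt_iterate_R_nat_mul_pi hr hr1 (2 * m + 1) 1).deriv
  rw [prod_range_two_mul_add_one_of_alternating _ fun i => by rw [← add_assoc, pow_add]; simp]
    at h0 h1
  constructor
  · simpa using h0
  · simpa [mul_comm] using h1
end

section
/- For every 0 < r < 1 and every n ≥ 1, the derivative of the n-th iterate at the 2-periodic point φ_c satisfies (R_r^n)'(φ_c) = (R_r'(φ_c))^n, and moreover R_r'(φ_c) > 1. -/
open Real Filter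

theorem one_sub_mul_cos_pos {r : ℝ} (hr : 0 < r) (hr1 : r < 1) (φ : ℝ) :
    0 < 1 - r * cos φ := by
  nlinarith [cos_le_one φ]

theorem one_add_sq_sub_mul_cos_pos {r : ℝ} (hr : 0 < r) (hr1 : r < 1) (φ : ℝ) :
    0 < 1 + r ^ 2 - 2 * r * cos φ := by
  nlinarith [cos_le_one φ, sq_pos_of_pos (sub_pos.2 hr1)]

theorem hasDerivAt_R {r : ℝ} (hr : 0 < r) (hr1 : r < 1) (φ : ℝ) :
    HasDerivAt (R r) ((1 + 3 * r ^ 2 - 4 * r * cos φ) / (1 + r ^ 2 - 2 * r * cos φ)) φ := by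
  have hp := one_sub_mul_cos_pos hr hr1 φ
  have hD := one_add_sq_sub_mul_cos_pos hr hr1 φ
  have h1 : HasDerivAt (fun x => r * sin x / (1 - r * cos x)) _ φ :=
    ((hasDerivAt_sin φ).const_mul r).div
      (((hasDerivAt_cos φ).const_mul r).const_sub 1) hp.ne'
  have h2 := ((hasDerivAt_id φ).add_const π).sub (h1.arctan.const_mul 2)
  refine h2.congr_deriv ?_
  have hs : sin φ ^ 2 = 1 - cos φ ^ 2 := sin_sq φ
  have hsum : 1 + (r * sin φ / (1 - r * cos φ)) ^ 2
      = (1 + r ^ 2 - 2 * r * cos φ) / (1 - r * cos φ) ^ 2 := by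
    field_simp
    linear_combination r ^ 2 * hs
  rw [hsum]
  field_simp
  linear_combination 2 * r ^ 2 * hs

/-- The roots of `2 r c² = c + r` are cosines of angles whose reflection has the same cosine. -/
theorem cos_R_eq {r : ℝ} (hr : 0 < r) (hr1 : r < 1) {φ : ℝ}
    (h : 2 * r * cos φ ^ 2 = cos φ + r) : cos (R r φ) = cos φ := by
  have hp := one_sub_mul_cos_pos hr hr1 φ
  have hD := one_add_sq_sub_mul_cos_pos hr hr1 φ
  have hs : sin φ ^ 2 = 1 - cos φ ^ 2 := sin_sq φ
  set t := r * sin φ / (1 - r * cos φ) with ht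
  have hsum : 1 + t ^ 2 = (1 + r ^ 2 - 2 * r * cos φ) / (1 - r * cos φ) ^ 2 := by
    rw [ht]
    field_simp
    linear_combination r ^ 2 * hs
  have hc2 : cos (arctan t) ^ 2 = (1 - r * cos φ) ^ 2 / (1 + r ^ 2 - 2 * r * cos φ) := by
    rw [cos_sq_arctan, hsum, one_div_div]
  have hsin : sin (arctan t) = t * cos (arctan t) := by
    rw [← tan_mul_cos (cos_arctan_pos t).ne', tan_arctan]
  have hR : R r φ = φ - 2 * arctan t + π := by
    rw [R]
    ring
  have hexp : cos (R r φ) = -(cos φ * (2 * cos (arctan t) ^ 2 - 1)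
      + sin φ * (2 * t * cos (arctan t) ^ 2)) := by
    rw [hR, cos_add_pi, cos_sub, cos_two_mul, sin_two_mul, hsin]
    ring
  have key : -(cos φ * (2 * (1 - r * cos φ) ^ 2 - (1 + r ^ 2 - 2 * r * cos φ))
      + 2 * r * sin φ ^ 2 * (1 - r * cos φ)) = cos φ * (1 + r ^ 2 - 2 * r * cos φ) := by
    rw [hs]
    linear_combination (2 - 2 * r * cos φ) * h
  rw [hexp, hc2, ht]
  generalize 1 + r ^ 2 - 2 * r * cos φ = D at hD key ⊢
  field_simp
  linear_combination key

theorem cos_φc {r : ℝ} (hr : 0 < r) :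
    cos (φc r) = (1 - Real.sqrt (1 + 8 * r ^ 2)) / (4 * r) := by
  have hle : Real.sqrt (1 + 8 * r ^ 2) ≤ 1 + 4 * r :=
    Real.sqrt_le_iff.2 ⟨by positivity, by nlinarith⟩
  have hone : 1 ≤ Real.sqrt (1 + 8 * r ^ 2) := Real.one_le_sqrt.2 (by nlinarith)
  refine cos_arccos ?_ ?_
  · rw [le_div_iff₀ (by positivity)]
    linarith
  · rw [div_le_iff₀ (by positivity)]
    linarith

theorem two_mul_cos_φc_sq {r : ℝ} (hr : 0 < r) :
    2 * r * cos (φc r) ^ 2 = cos (φc r) + r := by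
  have hsq : Real.sqrt (1 + 8 * r ^ 2) ^ 2 = 1 + 8 * r ^ 2 := Real.sq_sqrt (by positivity)
  rw [cos_φc hr]
  generalize Real.sqrt (1 + 8 * r ^ 2) = s at hsq ⊢
  field_simp
  linear_combination 2 * hsq

theorem cos_φc_nonpos {r : ℝ} (hr : 0 < r) : cos (φc r) ≤ 0 := by
  rw [cos_φc hr]
  have hone : 1 ≤ Real.sqrt (1 + 8 * r ^ 2) := Real.one_le_sqrt.2 (by nlinarith)
  exact div_nonpos_of_nonpos_of_nonneg (by linarith) (by positivity)

theorem cos_iterate_R_φc {r : ℝ} (hr : 0 < r) (hr1 : r < 1) (n : ℕ) :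
    cos ((R r)^[n] (φc r)) = cos (φc r) := by
  induction n with
  | zero => rfl
  | succ n ih =>
    rw [Function.iterate_succ_apply', cos_R_eq hr hr1, ih]
    rw [ih]
    exact two_mul_cos_φc_sq hr

theorem hasDerivAt_iterate_R_φc {r : ℝ} (hr : 0 < r) (hr1 : r < 1) (n : ℕ) :
    HasDerivAt ((R r)^[n]) (deriv (R r) (φc r) ^ n) (φc r) := by
  induction n with
  | zero => simpa using hasDerivAt_id (φc r)
  | succ n ih =>
    have h := hasDerivAt_R hr hr1 ((R r)^[n] (φc r))
    rw [cos_iterate_R_φc hr hr1, ← (hasDerivAt_R hr hr1 (φc r)).deriv] at h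
    rw [Function.iterate_succ', pow_succ']
    exact h.comp (φc r) ih

theorem stmt_6 (r : ℝ) (hr : 0 < r) (hr1 : r < 1) (n : ℕ) (hn : 1 ≤ n) :
    deriv ((R r)^[n]) (φc r) = (deriv (R r) (φc r)) ^ n ∧
    1 < deriv (R r) (φc r) := by
  refine ⟨(hasDerivAt_iterate_R_φc hr hr1 n).deriv, ?_⟩
  rw [(hasDerivAt_R hr hr1 (φc r)).deriv,
    one_lt_div (one_add_sq_sub_mul_cos_pos hr hr1 (φc r))]
  nlinarith [cos_φc_nonpos hr]
end

section
/- Let 0 < r < 1, m ≥ 1, and φ ∈ ℝ with R_r^{2m}(φ) ≡ φ (mod 2π) and (R_r^{2m})'(φ) ≠ −1. Then the caustic of R_r^{2m} is tangent to the unit circle at (cos φ, sin φ): its velocity vector at φ is orthogonal to the radius, i.e. x_{2m}'(φ)·cos φ + y_{2m}'(φ)·sin φ = 0. -/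
open Real Filter

/-- A light source inside the unit circle gives a `C²` reflection map. -/
lemma contDiff_R {r : ℝ} (hr : 0 < r) (hr1 : r < 1) : ContDiff ℝ 2 (R r) := by
  have hden (x : ℝ) : 1 - r * cos x ≠ 0 := by
    nlinarith [cos_le_one x]
  have hquot : ContDiff ℝ 2 fun x => r * sin x / (1 - r * cos x) :=
    (contDiff_const.mul contDiff_sin).div
      (contDiff_const.sub (contDiff_const.mul contDiff_cos)) hden
  exact (contDiff_id.add contDiff_const).sub (contDiff_const.mul hquot.arctan)

lemma contDiff_iterate {F : ℝ → ℝ} {k : WithTop ℕ∞} (hF : ContDiff ℝ k F) (n : ℕ) :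
    ContDiff ℝ k F^[n] := by
  induction n with
  | zero => exact contDiff_id
  | succ n ih => exact ih.comp hF

/-- At a point fixed modulo `2π` with `F' ≠ -1`, the envelope of the chords joining the points of
angle `φ` and `F φ` has velocity orthogonal to the radius. -/
lemma envelope_velocity_orthogonal_radius {F : ℝ → ℝ} {φ : ℝ} (hF : ContDiff ℝ 2 F)
    (hcos : cos (F φ) = cos φ) (hsin : sin (F φ) = sin φ) (hd : 1 + deriv F φ ≠ 0) :
    deriv (fun t => (deriv F t * cos t + cos (F t)) / (1 + deriv F t)) φ * cos φ +
      deriv (fun t => (deriv F t * sin t + sin (F t)) / (1 + deriv F t)) φ * sin φ = 0 := by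
  have h1 : HasDerivAt F (deriv F φ) φ := (hF.differentiable two_ne_zero φ).hasDerivAt
  have h2 : HasDerivAt (deriv F) (deriv (deriv F) φ) φ :=
    (hF.differentiable_deriv_two φ).hasDerivAt
  have hx := ((h2.fun_mul (hasDerivAt_cos φ)).fun_add h1.cos).fun_div (h2.const_add 1) hd
  have hy := ((h2.fun_mul (hasDerivAt_sin φ)).fun_add h1.sin).fun_div (h2.const_add 1) hd
  rw [hx.deriv, hy.deriv, hcos, hsin]
  field_simp
  ring

theorem stmt_14 (r : ℝ) (hr : 0 < r) (hr1 : r < 1) (m : ℕ) (hm : 1 ≤ m)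
    (φ : ℝ) (hper : ∃ k : ℤ, (R r)^[2 * m] φ = φ + 2 * π * k)
    (hd : deriv ((R r)^[2 * m]) φ ≠ -1) :
    deriv (xc r (2 * m)) φ * cos φ + deriv (yc r (2 * m)) φ * sin φ = 0 := by
  obtain ⟨k, hk⟩ := hper
  rw [mul_comm (2 * π)] at hk
  refine envelope_velocity_orthogonal_radius (contDiff_iterate (contDiff_R hr hr1) (2 * m)) ?_ ?_ ?_
  · rw [hk, cos_add_int_mul_two_pi]
  · rw [hk, sin_add_int_mul_two_pi]
  · exact fun h => hd (by linarith)
end
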